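/- arXiv:0806.3520 — 2 statements merged into one kernel-verified Lean document; each statement's English description precedes it below -/
import Mathlib

section
/- Let T₁,T₂,T₃,T₄ be an n×n matrix representation of the Nambu–Lie 3-algebra 𝒜₄, and suppose T₄ = t·I is a scalar matrix with t ≠ 0. Then necessarily T₁² + T₂² + T₃² = −t²·I. -/
/-- The Nambu commutator of three square complex matrices:
`[A,B,C]_N = ABC + BCA + CAB − BAC − ACB − CBA`. -/
noncomputable def nambu {n : ℕ} (A B C : Matrix (Fin n) (Fin n) ℂ) :
    Matrix (Fin n) (Fin n) ℂ :=
  A * B * C + B * C * A + C * A * B - B * A * C - A * C * B - C * B * A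

/-- The totally antisymmetric tensor `ε_{abcd}` on four indices with
`ε_{1234} = +1` (indices `1,2,3,4` are represented by `0,1,2,3 : Fin 4`). -/
def eps4 (a b c d : Fin 4) : ℤ :=
  ∑ σ : Equiv.Perm (Fin 4),
    if σ 0 = a ∧ σ 1 = b ∧ σ 2 = c ∧ σ 3 = d then (Equiv.Perm.sign σ : ℤ) else 0

/-- The Nambu commutator with a scalar matrix is a multiple of the commutator. -/
theorem nambu_smul_one {n : ℕ} (A B : Matrix (Fin n) (Fin n) ℂ) (t : ℂ) :
    nambu A B (t • 1) = t • (A * B - B * A) := by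
  simp only [nambu, mul_smul_comm, smul_mul_assoc, mul_one, one_mul, smul_sub]
  abel

/-- The Nambu commutator expressed through ordinary commutators. -/
theorem nambu_eq_mul_commutators {n : ℕ} (A B C : Matrix (Fin n) (Fin n) ℂ) :
    nambu A B C = A * (B * C - C * B) + B * (C * A - A * C) + C * (A * B - B * A) := by
  simp only [nambu, mul_sub, mul_assoc]
  abel

/-- If `T₁,T₂,T₃,T₄` is an `n×n` matrix representation of the Nambu–Lie
3-algebra `𝒜₄` with `T₄ = t·I`, `t ≠ 0`, then `T₁² + T₂² + T₃² = −t²·I`. -/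
theorem A4_rep_scalar_T4_casimir (n : ℕ) (T : Fin 4 → Matrix (Fin n) (Fin n) ℂ)
    (hrep : ∀ a b c : Fin 4,
      nambu (T a) (T b) (T c) = Complex.I • ∑ d, (eps4 a b c d : ℂ) • T d)
    (t : ℂ) (ht : t ≠ 0)
    (hT4 : T 3 = t • 1) :
    T 0 * T 0 + T 1 * T 1 + T 2 * T 2 = (-(t ^ 2)) • (1 : Matrix (Fin n) (Fin n) ℂ) := by
  have commutator_eq (a b c : Fin 4)
      (h : ∀ d, eps4 a b 3 d = if d = c then -1 else 0) :
      t • (T a * T b - T b * T a) = (-Complex.I) • T c := by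
    rw [← nambu_smul_one, ← hT4, hrep]
    simp [h]
  have h01 := commutator_eq 0 1 2 (by decide)
  have h12 := commutator_eq 1 2 0 (by decide)
  have h20 := commutator_eq 2 0 1 (by decide)
  have h012 : nambu (T 0) (T 1) (T 2) = (Complex.I * t) • 1 := by
    have h : ∀ d, eps4 0 1 2 d = if d = 3 then 1 else 0 := by decide
    rw [hrep]
    simp [h, hT4, mul_smul]
  have key : (-Complex.I) • (T 0 * T 0 + T 1 * T 1 + T 2 * T 2) =
      (-Complex.I) • ((-(t ^ 2)) • (1 : Matrix (Fin n) (Fin n) ℂ)) := by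
    calc (-Complex.I) • (T 0 * T 0 + T 1 * T 1 + T 2 * T 2)
        = t • nambu (T 0) (T 1) (T 2) := by
          rw [nambu_eq_mul_commutators]
          simp only [smul_add, ← mul_smul_comm, h01, h12, h20]
      _ = (-Complex.I) • ((-(t ^ 2)) • (1 : Matrix (Fin n) (Fin n) ℂ)) := by
          rw [h012, smul_smul, smul_smul]
          congr 1
          ring
  exact smul_right_injective _ (neg_ne_zero.mpr Complex.I_ne_zero) key
end

section
/- Explicit two-dimensional representation of 𝒜₄ from the spin-1/2 representation of su(2): let σ₁,σ₂,σ₃ be the Pauli matrices and let t ∈ ℂ satisfy t⁴ = −3/4. Then the 2×2 matrices T_i := −t^{−1} σ_i/2 (i = 1,2,3) and T₄ := t·I satisfy [T_a,T_b,T_c]_N = i Σ_{d=1}^{4} ε_{abcd} T_d for all a,b,c ∈ {1,2,3,4}. -/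
/-- The first Pauli matrix `σ₁ = [[0,1],[1,0]]`. -/
def pauli1 : Matrix (Fin 2) (Fin 2) ℂ := !![0, 1; 1, 0]

/-- The second Pauli matrix `σ₂ = [[0,−i],[i,0]]`. -/
noncomputable def pauli2 : Matrix (Fin 2) (Fin 2) ℂ := !![0, -Complex.I; Complex.I, 0]

/-- The third Pauli matrix `σ₃ = [[1,0],[0,−1]]`. -/
def pauli3 : Matrix (Fin 2) (Fin 2) ℂ := !![1, 0; 0, -1]

/-- The Levi-Civita symbol as a normalized Vandermonde product. -/
theorem twelve_mul_eps4 : ∀ a b c d : Fin 4,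
    12 * eps4 a b c d = ((b : ℤ) - a) * (c - a) * (d - a) * (c - b) * (d - b) * (d - c) := by
  decide +kernel

theorem eps4_cast (a b c d : Fin 4) : (eps4 a b c d : ℂ) =
    ((b : ℕ) - (a : ℕ)) * ((c : ℕ) - (a : ℕ)) * ((d : ℕ) - (a : ℕ)) * ((c : ℕ) - (b : ℕ)) *
      ((d : ℕ) - (b : ℕ)) * ((d : ℕ) - (c : ℕ)) / 12 := by
  have h := congrArg (Int.cast : ℤ → ℂ) (twelve_mul_eps4 a b c d)
  push_cast at h
  rw [← h]
  ring

theorem nambu_swap_left {n : ℕ} (A B C : Matrix (Fin n) (Fin n) ℂ) :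
    nambu B A C = -nambu A B C := by
  unfold nambu
  abel

theorem nambu_swap_right {n : ℕ} (A B C : Matrix (Fin n) (Fin n) ℂ) :
    nambu A C B = -nambu A B C := by
  unfold nambu
  abel

theorem nambu_self_left {n : ℕ} (A C : Matrix (Fin n) (Fin n) ℂ) : nambu A A C = 0 := by
  unfold nambu
  abel

theorem eps4_swap_left (a b c d : Fin 4) : (eps4 b a c d : ℂ) = -eps4 a b c d := by
  simp only [eps4_cast]
  ring

theorem eps4_swap_right (a b c d : Fin 4) : (eps4 a c b d : ℂ) = -eps4 a b c d := by
  simp only [eps4_cast]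
  ring

theorem eps4_self_left (a c d : Fin 4) : (eps4 a a c d : ℂ) = 0 := by
  simp [eps4_cast]

/-- A Nambu bracket relation with Levi-Civita structure constants need only be checked on
strictly increasing indices. -/
theorem nambu_eq_of_lt {n : ℕ} (T : Fin 4 → Matrix (Fin n) (Fin n) ℂ) (k : ℂ)
    (h : ∀ a b c : Fin 4, a < b → b < c →
      nambu (T a) (T b) (T c) = k • ∑ d, (eps4 a b c d : ℂ) • T d) (a b c : Fin 4) :
    nambu (T a) (T b) (T c) = k • ∑ d, (eps4 a b c d : ℂ) • T d := by
  have swap_left : ∀ a b c : Fin 4,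
      nambu (T a) (T b) (T c) = k • ∑ d, (eps4 a b c d : ℂ) • T d →
      nambu (T b) (T a) (T c) = k • ∑ d, (eps4 b a c d : ℂ) • T d := fun a b c h => by
    simp [nambu_swap_left (T a), eps4_swap_left a, h]
  have swap_right : ∀ a b c : Fin 4,
      nambu (T a) (T b) (T c) = k • ∑ d, (eps4 a b c d : ℂ) • T d →
      nambu (T a) (T c) (T b) = k • ∑ d, (eps4 a c b d : ℂ) • T d := fun a b c h => by
    simp [nambu_swap_right (T a) (T b), eps4_swap_right a b, h]
  have self_left : ∀ a c : Fin 4,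
      nambu (T a) (T a) (T c) = k • ∑ d, (eps4 a a c d : ℂ) • T d := fun a c => by
    simp [nambu_self_left, eps4_self_left]
  have of_lt : ∀ a b c : Fin 4, a < b →
      nambu (T a) (T b) (T c) = k • ∑ d, (eps4 a b c d : ℂ) • T d := fun a b c hab => by
    rcases lt_trichotomy b c with hbc | rfl | hcb
    · exact h a b c hab hbc
    · exact swap_left _ _ _ (swap_right _ _ _ (self_left b a))
    · rcases lt_trichotomy a c with hac | rfl | hca
      · exact swap_right _ _ _ (h a c b hac hcb)
      · exact swap_right _ _ _ (self_left a b)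
      · exact swap_right _ _ _ (swap_left _ _ _ (h c a b hca hab))
  rcases lt_trichotomy a b with hab | rfl | hba
  · exact of_lt a b c hab
  · exact self_left a c
  · exact swap_left _ _ _ (of_lt b a c hba)

/-- Explicit two-dimensional representation of `𝒜₄` from the spin-1/2
representation of su(2): if `t⁴ = −3/4` then `T_i := −t⁻¹ σ_i/2` (`i = 1,2,3`)
and `T₄ := t·I` satisfy `[T_a,T_b,T_c]_N = i Σ_d ε_{abcd} T_d`. -/
theorem pauli_A4_rep (t : ℂ) (ht : t ^ 4 = -(3 / 4))
    (T : Fin 4 → Matrix (Fin 2) (Fin 2) ℂ)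
    (hT1 : T 0 = (-(t⁻¹) / 2) • pauli1)
    (hT2 : T 1 = (-(t⁻¹) / 2) • pauli2)
    (hT3 : T 2 = (-(t⁻¹) / 2) • pauli3)
    (hT4 : T 3 = t • 1) :
    ∀ a b c : Fin 4,
      nambu (T a) (T b) (T c) = Complex.I • ∑ d, (eps4 a b c d : ℂ) • T d := by
  have ht0 : t ≠ 0 := by
    rintro rfl
    norm_num at ht
  have hinv : t * t⁻¹ = 1 := mul_inv_cancel₀ ht0
  have hcube : t⁻¹ ^ 3 = -(4 / 3) * t := by
    field_simp
    linear_combination 4 * ht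
  have hI : Complex.I ^ 2 = -1 := Complex.I_sq
  have h1 : T 0 = !![0, -(t⁻¹) / 2; -(t⁻¹) / 2, 0] := by simp [hT1, pauli1]
  have h2 : T 1 = !![0, Complex.I * t⁻¹ / 2; -(Complex.I * t⁻¹) / 2, 0] := by
    rw [hT2, pauli2]
    ext i j
    fin_cases i <;> fin_cases j <;> simp <;> ring
  have h3 : T 2 = !![-(t⁻¹) / 2, 0; 0, t⁻¹ / 2] := by
    rw [hT3, pauli3]
    ext i j
    fin_cases i <;> fin_cases j <;> simp <;> ring
  have h4 : T 3 = !![t, 0; 0, t] := by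
    rw [hT4]
    ext i j
    fin_cases i <;> fin_cases j <;> simp
  clear hT1 hT2 hT3 hT4
  generalize t⁻¹ = s at *
  generalize Complex.I = I at *
  refine nambu_eq_of_lt T I fun a b c hab hbc => ?_
  simp only [eps4_cast, Fin.sum_univ_four, nambu]
  fin_cases a <;> fin_cases b <;> first | exact absurd hab (by decide) | skip
  all_goals fin_cases c <;> first | exact absurd hbc (by decide) | skip
  all_goals
    simp only [Fin.zero_eta, Fin.mk_one, Fin.reduceFinMk, h1, h2, h3, h4]
    ext i j
    fin_cases i <;> fin_cases j <;> simp <;> norm_num <;> grind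
end
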